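/- (Proposition 2, second estimand.) Let α₁, α₂, β, γ₁, γ₂ be integrable real random variables on a probability space with α₁·β, α₁·γ₁, α₂·β, α₂·γ₂ integrable, satisfying Cov(α₁, β) = 0, Cov(α₁, γ₁) = 0, Cov(α₂, β) = 0, Cov(α₂, γ₂) = 0. Write ω_j = E[β] + E[γ_j] and κ_j(1) = E[α_j·(β + γ_j)] = E[α_j]·ω_j. Let ξ₁, ξ₂ be real numbers with ω₁ > 0, ω₂ > 0, ω₁ + ξ₁ > 0, E[α₁] > 0, E[α₂] > 0, ω₂·ξ₁ > ω₁·ξ₂, and let τ₁ > 0, τ₂ > 0 be real numbers. Let (Â₁ᴺ), (Â₂ᴺ), (Ŵ₁ᴺ), (Ŵ₂ᴺ), (τ̂₁ᴺ), (τ̂₂ᴺ) be sequences of real random variables with Â₁ᴺ → E[α₁], Â₂ᴺ → E[α₂], Ŵ₁ᴺ → ω₁ + ξ₁, Ŵ₂ᴺ → ω₂ + ξ₂, τ̂₁ᴺ → τ₁, τ̂₂ᴺ → τ₂ in probability. Then the estimator ((Â₂ᴺ·Ŵ₂ᴺ)/τ̂₂ᴺ)/((Â₁ᴺ·Ŵ₁ᴺ)/τ̂₁ᴺ)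 converges in probability to the constant (E[α₂]·(ω₂ + ξ₂)·τ₁)/(E[α₁]·(ω₁ + ξ₁)·τ₂), and this limit is strictly less than (κ₂(1)/τ₂)/(κ₁(1)/τ₁) = (E[α₂]·ω₂·τ₁)/(E[α₁]·ω₁·τ₂). -/

import Mathlib

open MeasureTheory Filter

/-- Continuous mapping for convergence in measure to constants (two arguments). -/
lemma tendstoInMeasure_map_two {Ω : Type*} [MeasurableSpace Ω] {μ : Measure Ω}
    {X Y : ℕ → Ω → ℝ} {a b : ℝ} (F : ℝ → ℝ → ℝ)
    (hX : TendstoInMeasure μ X atTop (fun _ => a))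
    (hY : TendstoInMeasure μ Y atTop (fun _ => b))
    (hF : ContinuousAt (fun p : ℝ × ℝ => F p.1 p.2) (a, b)) :
    TendstoInMeasure μ (fun N x => F (X N x) (Y N x)) atTop (fun _ => F a b) := by
  rw [tendstoInMeasure_iff_dist] at *
  intro ε hε
  obtain ⟨δ, hδ, h⟩ := Metric.continuousAt_iff.1 hF ε hε
  have hsum := (hX δ hδ).add (hY δ hδ)
  rw [add_zero] at hsum
  refine tendsto_of_tendsto_of_tendsto_of_le_of_le tendsto_const_nhds hsum
    (fun _ => zero_le) (fun N => ?_)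
  refine (measure_mono ?_).trans (measure_union_le _ _)
  intro x hx
  by_contra hc
  simp only [Set.mem_union, Set.mem_setOf_eq, not_or, not_le] at hc hx
  have := h (x := (X N x, Y N x)) (by rw [Prod.dist_eq]; exact max_lt hc.1 hc.2)
  exact absurd hx (not_le.2 this)

/-- Proposition 2, second estimand: the ratio-of-proportions-mediated estimator
`((Â₂ᴺ·Ŵ₂ᴺ)/τ̂₂ᴺ)/((Â₁ᴺ·Ŵ₁ᴺ)/τ̂₁ᴺ)` converges in probability to
`(E[α₂]·(ω₂+ξ₂)·τ₁)/(E[α₁]·(ω₁+ξ₁)·τ₂)`, which is strictly less than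
`(κ₂(1)/τ₂)/(κ₁(1)/τ₁) = (E[α₂]·ω₂·τ₁)/(E[α₁]·ω₁·τ₂)`. -/
theorem ccm_proposition_two_second_estimand
    {Ω : Type*} [MeasurableSpace Ω] (μ : Measure Ω) [IsProbabilityMeasure μ]
    (α₁ α₂ β γ₁ γ₂ : Ω → ℝ)
    (hα₁ : Integrable α₁ μ) (hα₂ : Integrable α₂ μ) (hβ : Integrable β μ)
    (hγ₁ : Integrable γ₁ μ) (hγ₂ : Integrable γ₂ μ)
    (hα₁β : Integrable (fun x => α₁ x * β x) μ)
    (hα₁γ₁ : Integrable (fun x => α₁ x * γ₁ x) μ)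
    (hα₂β : Integrable (fun x => α₂ x * β x) μ)
    (hα₂γ₂ : Integrable (fun x => α₂ x * γ₂ x) μ)
    (hcov₁β : ∫ x, α₁ x * β x ∂μ - (∫ x, α₁ x ∂μ) * (∫ x, β x ∂μ) = 0)
    (hcov₁γ : ∫ x, α₁ x * γ₁ x ∂μ - (∫ x, α₁ x ∂μ) * (∫ x, γ₁ x ∂μ) = 0)
    (hcov₂β : ∫ x, α₂ x * β x ∂μ - (∫ x, α₂ x ∂μ) * (∫ x, β x ∂μ) = 0)
    (hcov₂γ : ∫ x, α₂ x * γ₂ x ∂μ - (∫ x, α₂ x ∂μ) * (∫ x, γ₂ x ∂μ) = 0)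
    (ξ₁ ξ₂ τ₁ τ₂ : ℝ)
    (hω₁pos : 0 < (∫ x, β x ∂μ) + (∫ x, γ₁ x ∂μ))
    (hω₂pos : 0 < (∫ x, β x ∂μ) + (∫ x, γ₂ x ∂μ))
    (hω₁ξpos : 0 < ((∫ x, β x ∂μ) + (∫ x, γ₁ x ∂μ)) + ξ₁)
    (hα₁pos : 0 < ∫ x, α₁ x ∂μ) (hα₂pos : 0 < ∫ x, α₂ x ∂μ)
    (hcond : ((∫ x, β x ∂μ) + (∫ x, γ₂ x ∂μ)) * ξ₁
      > ((∫ x, β x ∂μ) + (∫ x, γ₁ x ∂μ)) * ξ₂)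
    (hτ₁pos : 0 < τ₁) (hτ₂pos : 0 < τ₂)
    (A₁ A₂ W₁ W₂ τh₁ τh₂ : ℕ → Ω → ℝ)
    (hA₁ : TendstoInMeasure μ A₁ atTop (fun _ => ∫ x, α₁ x ∂μ))
    (hA₂ : TendstoInMeasure μ A₂ atTop (fun _ => ∫ x, α₂ x ∂μ))
    (hW₁ : TendstoInMeasure μ W₁ atTop
      (fun _ => ((∫ x, β x ∂μ) + (∫ x, γ₁ x ∂μ)) + ξ₁))
    (hW₂ : TendstoInMeasure μ W₂ atTop
      (fun _ => ((∫ x, β x ∂μ) + (∫ x, γ₂ x ∂μ)) + ξ₂))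
    (hτh₁ : TendstoInMeasure μ τh₁ atTop (fun _ => τ₁))
    (hτh₂ : TendstoInMeasure μ τh₂ atTop (fun _ => τ₂)) :
    TendstoInMeasure μ
      (fun N x => ((A₂ N x * W₂ N x) / τh₂ N x) / ((A₁ N x * W₁ N x) / τh₁ N x)) atTop
      (fun _ => ((∫ x, α₂ x ∂μ) * (((∫ x, β x ∂μ) + (∫ x, γ₂ x ∂μ)) + ξ₂) * τ₁)
        / ((∫ x, α₁ x ∂μ) * (((∫ x, β x ∂μ) + (∫ x, γ₁ x ∂μ)) + ξ₁) * τ₂)) ∧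
    ((∫ x, α₂ x ∂μ) * (((∫ x, β x ∂μ) + (∫ x, γ₂ x ∂μ)) + ξ₂) * τ₁)
        / ((∫ x, α₁ x ∂μ) * (((∫ x, β x ∂μ) + (∫ x, γ₁ x ∂μ)) + ξ₁) * τ₂)
      < ((∫ x, α₂ x * (β x + γ₂ x) ∂μ) / τ₂) / ((∫ x, α₁ x * (β x + γ₁ x) ∂μ) / τ₁) ∧
    ((∫ x, α₂ x * (β x + γ₂ x) ∂μ) / τ₂) / ((∫ x, α₁ x * (β x + γ₁ x) ∂μ) / τ₁)
      = ((∫ x, α₂ x ∂μ) * ((∫ x, β x ∂μ) + (∫ x, γ₂ x ∂μ)) * τ₁)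
        / ((∫ x, α₁ x ∂μ) * ((∫ x, β x ∂μ) + (∫ x, γ₁ x ∂μ)) * τ₂) := by
  have h1 : ∫ x, α₁ x * (β x + γ₁ x) ∂μ
      = (∫ x, α₁ x ∂μ) * ((∫ x, β x ∂μ) + (∫ x, γ₁ x ∂μ)) := by
    simp only [mul_add]
    rw [integral_add hα₁β hα₁γ₁]
    linarith
  have h2 : ∫ x, α₂ x * (β x + γ₂ x) ∂μ
      = (∫ x, α₂ x ∂μ) * ((∫ x, β x ∂μ) + (∫ x, γ₂ x ∂μ)) := by
    simp only [mul_add]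
    rw [integral_add hα₂β hα₂γ₂]
    linarith
  rw [h1, h2]
  clear h1 h2 hcov₁β hcov₁γ hcov₂β hcov₂γ
  generalize (∫ x, β x ∂μ) + (∫ x, γ₁ x ∂μ) = w₁ at *
  generalize (∫ x, β x ∂μ) + (∫ x, γ₂ x ∂μ) = w₂ at *
  generalize (∫ x, α₁ x ∂μ) = a₁ at *
  generalize (∫ x, α₂ x ∂μ) = a₂ at *
  have heq : a₂ * w₂ / τ₂ / (a₁ * w₁ / τ₁) = a₂ * w₂ * τ₁ / (a₁ * w₁ * τ₂) := by
    field_simp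
  refine ⟨?_, ?_, heq⟩
  · have hmul : ∀ p : ℝ × ℝ, ContinuousAt (fun p : ℝ × ℝ => p.1 * p.2) p :=
      fun p => continuousAt_fst.mul continuousAt_snd
    have hdiv : ∀ a b : ℝ, b ≠ 0 → ContinuousAt (fun p : ℝ × ℝ => p.1 / p.2) (a, b) :=
      fun a b hb => continuousAt_fst.div continuousAt_snd hb
    have n2 := tendstoInMeasure_map_two (fun x y => x / y)
      (tendstoInMeasure_map_two (fun x y => x * y) hA₂ hW₂ (hmul _)) hτh₂
      (hdiv _ _ hτ₂pos.ne')
    have n1 := tendstoInMeasure_map_two (fun x y => x / y)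
      (tendstoInMeasure_map_two (fun x y => x * y) hA₁ hW₁ (hmul _)) hτh₁
      (hdiv _ _ hτ₁pos.ne')
    have n := tendstoInMeasure_map_two (fun x y => x / y) n2 n1
      (hdiv _ _ (by positivity))
    have e : a₂ * (w₂ + ξ₂) * τ₁ / (a₁ * (w₁ + ξ₁) * τ₂)
        = a₂ * (w₂ + ξ₂) / τ₂ / (a₁ * (w₁ + ξ₁) / τ₁) := by
      field_simp
    rw [e]
    exact n
  · rw [heq, div_lt_div_iff₀ (by positivity) (by positivity)]
    have hp : 0 < a₁ * a₂ * τ₁ * τ₂ := by positivity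
    have hc : 0 < w₂ * ξ₁ - w₁ * ξ₂ := by linarith
    nlinarith [mul_pos hp hc]
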